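/- arXiv:1903.10647 — 2 statements merged into one kernel-verified Lean document; each statement's English description precedes it below -/
import Mathlib

section
/- Let A be a rank-3 arrangement of n lines in P^2_K with singular points P_1,...,P_s and multiplicities n_j, and let I = ∩_j I(P_j)^{n_j - 1}. Then for every r ≥ 1, every nonzero homogeneous F in the symbolic power I^(2r-1) has degree at least rn - 1, i.e., α(I^(2r-1)) ≥ rn - 1. -/
open scoped Classical

/-- The homogeneous ideal of a point of `ℙ²` with homogeneous coordinate vector `p`:
the ideal generated by all linear forms vanishing at `p`. -/
noncomputable def pointIdeal {K : Type*} [Field K] (p : Fin 3 → K) :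
    Ideal (MvPolynomial (Fin 3) K) :=
  Ideal.span {f | f.IsHomogeneous 1 ∧ MvPolynomial.eval p f = 0}

section LinearForms

open MvPolynomial

variable {K : Type*} [Field K]

lemma MvPolynomial.IsHomogeneous.exists_eq_sum_C_mul_X {σ : Type*} [Fintype σ]
    {f : MvPolynomial σ K} (hf : f.IsHomogeneous 1) : ∃ a : σ → K, f = ∑ i, C (a i) * X i := by
  rw [← mem_homogeneousSubmodule, homogeneousSubmodule_one_eq_span_X,
    Submodule.mem_span_range_iff_exists_fun] at hf
  obtain ⟨a, rfl⟩ := hf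
  exact ⟨a, by simp [smul_eq_C_mul]⟩

lemma MvPolynomial.IsHomogeneous.eval_add_smul {σ : Type*} [Fintype σ] {f : MvPolynomial σ K}
    (hf : f.IsHomogeneous 1) (q w : σ → K) (t : K) :
    eval (q + t • w) f = eval q f + t * eval w f := by
  obtain ⟨a, rfl⟩ := hf.exists_eq_sum_C_mul_X
  simp only [map_sum, map_mul, eval_C, eval_X, Pi.add_apply, Pi.smul_apply, smul_eq_mul,
    Finset.mul_sum, ← Finset.sum_add_distrib]
  exact Finset.sum_congr rfl fun i _ => by ring

lemma MvPolynomial.IsHomogeneous.eval_smul_of_linear {σ : Type*} [Fintype σ]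
    {f : MvPolynomial σ K} (hf : f.IsHomogeneous 1) (c : K) (q : σ → K) :
    eval (c • q) f = c * eval q f := by
  obtain ⟨a, rfl⟩ := hf.exists_eq_sum_C_mul_X
  simp only [map_sum, map_mul, eval_C, eval_X, Pi.smul_apply, smul_eq_mul, Finset.mul_sum]
  exact Finset.sum_congr rfl fun i _ => by ring

/-- A nonzero linear form is a prime element. -/
lemma MvPolynomial.IsHomogeneous.prime {σ : Type*} [Fintype σ] {f : MvPolynomial σ K}
    (hf : f.IsHomogeneous 1) (h0 : f ≠ 0) : Prime f := by
  refine Irreducible.prime (irreducible_of_totalDegree_eq_one (hf.totalDegree h0) fun x hx => ?_)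
  obtain ⟨m, hm⟩ := ne_zero_iff.mp h0
  exact isUnit_iff_ne_zero.mpr fun h => hm (zero_dvd_iff.mp (h ▸ hx m))

/-- Two linear forms dividing one another are proportional. -/
lemma MvPolynomial.IsHomogeneous.exists_eq_smul_of_dvd {σ : Type*} {f g : MvPolynomial σ K}
    (hf : f.IsHomogeneous 1) (hg : g.IsHomogeneous 1) (hg0 : g ≠ 0) (h : f ∣ g) :
    ∃ c : K, g = c • f := by
  obtain ⟨u, rfl⟩ := h
  have hf0 := left_ne_zero_of_mul hg0
  have hu := totalDegree_mul_of_isDomain hf0 (right_ne_zero_of_mul hg0)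
  rw [hg.totalDegree hg0, hf.totalDegree hf0] at hu
  refine ⟨coeff 0 u, ?_⟩
  rw [smul_eq_C_mul, mul_comm]
  conv_lhs => rw [totalDegree_eq_zero_iff_eq_C.mp (by omega : u.totalDegree = 0)]

/-- A polynomial vanishing on the zero set of a nonzero linear form is divisible by it. -/
lemma MvPolynomial.IsHomogeneous.dvd_of_eval_eq_zero {σ : Type*} [Fintype σ] [Infinite K]
    {f F : MvPolynomial σ K} (hf : f.IsHomogeneous 1) (h0 : f ≠ 0)
    (h : ∀ q, eval q f = 0 → eval q F = 0) : f ∣ F := by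
  obtain ⟨e, he⟩ : ∃ e, eval e f ≠ 0 := by
    by_contra! H
    exact h0 (MvPolynomial.funext fun q => by simp [H q])
  set τ : MvPolynomial σ K →ₐ[K] MvPolynomial σ K :=
    MvPolynomial.aeval fun i => X i - C (e i * (eval e f)⁻¹) * f with hτ
  have hτF : τ F = 0 := by
    refine MvPolynomial.funext fun q => ?_
    have hq : eval q (τ F) = eval (q + (-(eval q f * (eval e f)⁻¹)) • e) F := by
      rw [hτ, MvPolynomial.aeval_def, ← coe_eval₂Hom, ← RingHom.comp_apply]
      refine congrFun (congrArg DFunLike.coe (ringHom_ext (fun r => ?_) fun i => ?_)) F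
      · simp
      · simp; ring
    rw [hq, h, map_zero]
    rw [hf.eval_add_smul]
    field_simp
    ring
  rw [← Ideal.mem_span_singleton, ← Ideal.Quotient.eq_zero_iff_mem]
  have hmk : (Ideal.Quotient.mkₐ K (Ideal.span {f})).comp τ =
      Ideal.Quotient.mkₐ K (Ideal.span {f}) := by
    refine algHom_ext fun i => ?_
    have : (Ideal.Quotient.mk (Ideal.span {f})) f = 0 :=
      Ideal.Quotient.eq_zero_iff_mem.mpr (Ideal.mem_span_singleton_self f)
    simp [hτ, this]
  have := DFunLike.congr_fun hmk F
  simpa [hτF] using this.symm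

/-- The zero set of a linear form in three variables is not contained in a line through `0`. -/
lemma exists_eval_eq_zero_notMem_span {f : MvPolynomial (Fin 3) K} (hf : f.IsHomogeneous 1)
    (q : Fin 3 → K) : ∃ v, eval v f = 0 ∧ v ∉ Submodule.span K {q} := by
  obtain ⟨a, rfl⟩ := hf.exists_eq_sum_C_mul_X
  let L : (Fin 3 → K) →ₗ[K] K := ∑ i, a i • LinearMap.proj i
  by_contra! H
  have hle : L.ker ≤ Submodule.span K {q} := fun v hv => H v (by
    simpa [L] using hv)
  have h0 : Module.finrank K (Submodule.span K {q}) ≤ 1 := by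
    simpa using finrank_span_le_card (R := K) ({q} : Set (Fin 3 → K))
  have h1 := (Submodule.finrank_mono hle).trans h0
  have h2 := L.finrank_range_add_finrank_ker
  have h3 := L.range.finrank_le
  simp at h2 h3
  omega

end LinearForms

section Expansion

open MvPolynomial

variable {K : Type*} [Field K]

/-- The Taylor expansion of a polynomial at `q`, as a polynomial in a new variable scaling the
displacement from `q`: the image of `F` under `xᵢ ↦ qᵢ + T xᵢ`. -/
noncomputable def expandAt {σ : Type*} (q : σ → K) :
    MvPolynomial σ K →ₐ[K] Polynomial (MvPolynomial σ K) :=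
  aeval fun i => Polynomial.C (C (q i)) + Polynomial.X * Polynomial.C (X i)

/-- The restriction of a polynomial to the parametrized line `t ↦ q + t w`. -/
noncomputable def restrictLine {σ : Type*} (q w : σ → K) :
    MvPolynomial σ K →ₐ[K] Polynomial K :=
  aeval fun i => Polynomial.C (q i) + Polynomial.X * Polynomial.C (w i)

lemma map_eval_expandAt {σ : Type*} (q w : σ → K) (F : MvPolynomial σ K) :
    (expandAt q F).map (eval w) = restrictLine q w F := by
  rw [← Polynomial.coe_mapRingHom, ← RingHom.coe_coe (expandAt q), ← RingHom.comp_apply,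
    ← RingHom.coe_coe (restrictLine q w)]
  refine congrFun (congrArg DFunLike.coe (ringHom_ext (fun r => ?_) fun i => ?_)) F
  · simp [Polynomial.algebraMap_apply]
  · simp [expandAt, restrictLine]

lemma restrictLine_add_smul_comp {σ : Type*} (q w : σ → K) (t : K) (F : MvPolynomial σ K) :
    (restrictLine (q + t • w) w F).comp (Polynomial.X - Polynomial.C t) = restrictLine q w F := by
  rw [← Polynomial.coe_compRingHom_apply, ← RingHom.coe_coe (restrictLine (q + t • w) w),
    ← RingHom.comp_apply, ← RingHom.coe_coe (restrictLine q w)]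
  refine congrFun (congrArg DFunLike.coe (ringHom_ext (fun r => ?_) fun i => ?_)) F
  · simp
  · simp [restrictLine]; ring

lemma eval_zero_restrictLine {σ : Type*} (q w : σ → K) (F : MvPolynomial σ K) :
    (restrictLine q w F).eval 0 = eval q F := by
  rw [← Polynomial.coe_evalRingHom, ← RingHom.coe_coe (restrictLine q w), ← RingHom.comp_apply]
  refine congrFun (congrArg DFunLike.coe (ringHom_ext (fun r => ?_) fun i => ?_)) F
  · simp
  · simp [restrictLine]

lemma natDegree_restrictLine_le {σ : Type*} (q w : σ → K) (F : MvPolynomial σ K) :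
    (restrictLine q w F).natDegree ≤ F.totalDegree := by
  have := aeval_natDegree_le (n := 1) F le_rfl
    (fun i => Polynomial.C (q i) + Polynomial.X * Polynomial.C (w i)) fun i => by compute_degree
  simpa [restrictLine] using this

lemma expandAt_linear {σ : Type*} [Fintype σ] {f : MvPolynomial σ K} (hf : f.IsHomogeneous 1)
    (q : σ → K) :
    expandAt q f = Polynomial.C (C (eval q f)) + Polynomial.X * Polynomial.C f := by
  obtain ⟨a, rfl⟩ := hf.exists_eq_sum_C_mul_X
  simp only [expandAt, map_sum, map_mul, aeval_X, algHom_C, Polynomial.algebraMap_apply,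
    MvPolynomial.algebraMap_eq, eval_C, eval_X, Finset.mul_sum, ← Finset.sum_add_distrib]
  exact Finset.sum_congr rfl fun i _ => by ring

lemma X_pow_dvd_expandAt_of_mem {q : Fin 3 → K} {a : ℕ} {F : MvPolynomial (Fin 3) K}
    (hF : F ∈ pointIdeal q ^ a) : Polynomial.X ^ a ∣ expandAt q F := by
  have hle : pointIdeal q ≤ (Ideal.span {Polynomial.X}).comap (expandAt q) := by
    rw [pointIdeal, Ideal.span_le]
    rintro f ⟨hf, hfq⟩
    simp [Ideal.mem_span_singleton, expandAt_linear hf, hfq]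
  have := Ideal.le_comap_pow (expandAt q) a (Ideal.pow_right_mono hle a hF)
  rwa [Ideal.mem_comap, Ideal.span_singleton_pow, Ideal.mem_span_singleton] at this

lemma pointIdeal_smul {c : K} (hc : c ≠ 0) (q : Fin 3 → K) :
    pointIdeal (c • q) = pointIdeal q := by
  unfold pointIdeal
  congr 1
  ext f
  refine and_congr_right fun hf => ?_
  simp [hf.eval_smul_of_linear, hc]

/-- If a product of nonzero linear forms, exactly `m` of which vanish at `q`, times `G` vanishes
to order `a + m` at `q`, then `G` vanishes to order `a` at `q`. -/
lemma X_pow_dvd_expandAt_of_prod_mul {ι σ : Type*} [Fintype σ] (s : Finset ι)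
    {ℓ : ι → MvPolynomial σ K} (hl : ∀ i, (ℓ i).IsHomogeneous 1) (hnz : ∀ i, ℓ i ≠ 0)
    (q : σ → K) (a : ℕ) (G : MvPolynomial σ K)
    (h : Polynomial.X ^ (a + (s.filter fun i => eval q (ℓ i) = 0).card) ∣
      expandAt q ((∏ i ∈ s, ℓ i) * G)) :
    Polynomial.X ^ a ∣ expandAt q G := by
  induction s using Finset.induction_on with
  | empty => simpa using h
  | insert i s his ih =>
    apply ih
    rw [Finset.prod_insert his, mul_assoc, map_mul, expandAt_linear (hl i)] at h
    have hX := Polynomial.prime_X (R := MvPolynomial σ K)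
    by_cases hi : eval q (ℓ i) = 0
    · rw [Finset.filter_insert, if_pos hi, Finset.card_insert_of_notMem (by simp [his]),
        ← add_assoc, pow_succ', hi, map_zero, map_zero, zero_add, mul_assoc,
        mul_dvd_mul_iff_left Polynomial.X_ne_zero] at h
      refine hX.pow_dvd_of_dvd_mul_left _ ?_ h
      simpa [Polynomial.X_dvd_iff] using hnz i
    · rw [Finset.filter_insert, if_neg hi] at h
      refine hX.pow_dvd_of_dvd_mul_left _ ?_ h
      simpa [Polynomial.X_dvd_iff] using hi

end Expansion

section Arrangement

open MvPolynomial

variable {K : Type*} [Field K]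

/-- Bézout on a line of an arrangement: a polynomial of degree less than `N (n - 1)` which vanishes
to order `N (m_q - 1)` at each point `q ≠ 0` lying on `m_q` lines is divisible by each line. -/
lemma linear_dvd_of_order [Infinite K] {n : ℕ}
    {ℓ : Fin n → MvPolynomial (Fin 3) K} (hl : ∀ i, (ℓ i).IsHomogeneous 1) (hnz : ∀ i, ℓ i ≠ 0)
    (hprop : ∀ i j, i ≠ j → ¬ ℓ i ∣ ℓ j) {N : ℕ} {F : MvPolynomial (Fin 3) K}
    (hdeg : F.totalDegree < N * (n - 1))
    (hord : ∀ q : Fin 3 → K, q ≠ 0 → Polynomial.X ^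
      (N * ((Finset.univ.filter fun i => eval q (ℓ i) = 0).card - 1)) ∣ expandAt q F)
    (i : Fin n) : ℓ i ∣ F := by
  have hpr := (hl i).prime (hnz i)
  suffices h : ℓ i ∣ F * ∏ j ∈ Finset.univ.erase i, ℓ j by
    refine (hpr.dvd_or_dvd h).resolve_right fun h' => ?_
    obtain ⟨j, hj, hij⟩ := hpr.exists_mem_finset_dvd h'
    exact hprop i j (Finset.ne_of_mem_erase hj).symm hij
  refine (hl i).dvd_of_eval_eq_zero (hnz i) fun q hq => ?_
  rw [map_mul, map_prod, mul_eq_zero, or_iff_not_imp_right, Finset.prod_eq_zero_iff]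
  intro hne
  push Not at hne
  obtain ⟨v, hv, hvq⟩ := exists_eval_eq_zero_notMem_span (hl i) q
  obtain ⟨t, ht⟩ := Infinite.exists_notMem_finset
    (Finset.univ.image fun j => -(eval v (ℓ j) / eval q (ℓ j)))
  set w := v + t • q with hw
  have hwi : eval w (ℓ i) = 0 := by rw [hw, (hl i).eval_add_smul, hv, hq]; simp
  have hwj : ∀ j ∈ Finset.univ.erase i, eval w (ℓ j) ≠ 0 := by
    intro j hj h0
    rw [hw, (hl j).eval_add_smul] at h0
    refine ht (Finset.mem_image.mpr ⟨j, Finset.mem_univ j, ?_⟩)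
    have := hne j hj
    field_simp
    linear_combination -h0
  have hwq : ∀ u : K, q + u • w ≠ 0 := by
    intro u hu
    have hu' : (1 + u * t) • q + u • v = 0 := by
      rw [← hu, hw]; module
    by_cases hu0 : u = 0
    · subst hu0
      have hq0 : q = 0 := by simpa using hu
      have : Nontrivial (Fin n) := Fin.nontrivial_iff_two_le.mpr (by
        by_contra! hn
        rw [Nat.sub_eq_zero_of_le (by omega)] at hdeg
        simp at hdeg)
      obtain ⟨j, hj⟩ := exists_ne i
      have h0 := (hl j).eval_smul_of_linear 0 0
      rw [smul_zero, zero_mul] at h0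
      exact hne j (Finset.mem_erase.mpr ⟨hj, Finset.mem_univ j⟩) (hq0 ▸ h0)
    · refine hvq (Submodule.mem_span_singleton.mpr ⟨-(u⁻¹ * (1 + u * t)), ?_⟩)
      have h2 := congrArg (fun x => u⁻¹ • x) hu'
      simp only [smul_add, smul_smul, inv_mul_cancel₀ hu0, one_smul, smul_zero] at h2
      rw [neg_smul]
      exact neg_eq_of_add_eq_zero_right h2
  rw [← eval_zero_restrictLine q w]
  suffices h : restrictLine q w F = 0 by simp [h]
  by_contra hg
  set M : Multiset K :=
    (Finset.univ.erase i).val.map fun j => -(eval q (ℓ j) / eval w (ℓ j)) with hM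
  have hMle : N • M ≤ (restrictLine q w F).roots := by
    rw [Multiset.le_iff_count]
    intro u
    rw [Multiset.count_nsmul, Polynomial.count_roots, Polynomial.le_rootMultiplicity_iff hg]
    have h1 := Polynomial.map_dvd (eval w) (hord (q + u • w) (hwq u))
    rw [map_eval_expandAt] at h1
    have h2 := map_dvd (Polynomial.compRingHom (Polynomial.X - Polynomial.C u)) h1
    simp only [Polynomial.coe_compRingHom_apply, restrictLine_add_smul_comp] at h2
    simp only [Polynomial.map_pow, Polynomial.map_X, Polynomial.pow_comp, Polynomial.X_comp] at h2
    refine (pow_dvd_pow _ (Nat.mul_le_mul_left N ?_)).trans h2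
    rw [hM, Multiset.count_map, ← Finset.filter_val, Finset.card_val,
      ← Finset.card_erase_of_mem (a := i)
        (by simp [(hl i).eval_add_smul, hq, hwi])]
    refine Finset.card_le_card fun j hj => ?_
    obtain ⟨hj, hju⟩ := Finset.mem_filter.mp hj
    have := hwj j hj
    simp only [Finset.mem_erase, Finset.mem_filter, Finset.mem_univ, true_and, and_true] at hj ⊢
    refine ⟨hj, ?_⟩
    rw [(hl j).eval_add_smul, hju]
    field_simp
    ring
  have h1 := (Multiset.card_le_card hMle).trans (Polynomial.card_roots' _)
  have h2 := natDegree_restrictLine_le q w F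
  simp [hM] at h1
  omega

/-- A polynomial divisible by pairwise non-proportional linear forms is divisible by their
product. -/
lemma prod_linear_dvd {ι σ : Type*} [Fintype σ] (s : Finset ι) {ℓ : ι → MvPolynomial σ K}
    (hl : ∀ i, (ℓ i).IsHomogeneous 1) (hnz : ∀ i, ℓ i ≠ 0)
    (hprop : ∀ i j, i ≠ j → ¬ ℓ i ∣ ℓ j) {F : MvPolynomial σ K} (h : ∀ i ∈ s, ℓ i ∣ F) :
    ∏ i ∈ s, ℓ i ∣ F := by
  induction s using Finset.induction_on with
  | empty => simp
  | insert i s his ih =>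
    obtain ⟨G, rfl⟩ := ih fun j hj => h j (Finset.mem_insert_of_mem hj)
    have hpr := (hl i).prime (hnz i)
    rw [Finset.prod_insert his, mul_comm]
    refine mul_dvd_mul_left _ ((hpr.dvd_or_dvd (h i (Finset.mem_insert_self i s))).resolve_left ?_)
    intro h'
    obtain ⟨j, hj, hij⟩ := hpr.exists_mem_finset_dvd h'
    exact hprop i j (fun e => his (e ▸ hj)) hij

/-- A nonzero polynomial vanishing to order `(2r - 1) (m_q - 1)` at each point `q ≠ 0` lying on
`m_q` of the `n` lines has degree at least `rn - 1`. -/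
lemma le_totalDegree_of_order [Infinite K] {n : ℕ} (hn : 2 ≤ n)
    {ℓ : Fin n → MvPolynomial (Fin 3) K} (hl : ∀ i, (ℓ i).IsHomogeneous 1) (hnz : ∀ i, ℓ i ≠ 0)
    (hprop : ∀ i j, i ≠ j → ¬ ℓ i ∣ ℓ j) (r : ℕ) {F : MvPolynomial (Fin 3) K} (hF : F ≠ 0)
    (hord : ∀ q : Fin 3 → K, q ≠ 0 → Polynomial.X ^
      ((2 * r - 1) * ((Finset.univ.filter fun i => eval q (ℓ i) = 0).card - 1)) ∣ expandAt q F) :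
    r * n - 1 ≤ F.totalDegree := by
  induction r generalizing F with
  | zero => simp
  | succ r ih =>
    by_contra! hlt
    have hdeg : F.totalDegree < (2 * (r + 1) - 1) * (n - 1) := by
      obtain ⟨k, rfl⟩ := Nat.exists_eq_add_of_le hn
      have e1 : 2 * (r + 1) - 1 = 2 * r + 1 := by omega
      have e2 : 2 + k - 1 = k + 1 := by omega
      rw [e1, e2]
      have : (r + 1) * (2 + k) - 1 ≤ (2 * r + 1) * (k + 1) := by
        rw [Nat.sub_le_iff_le_add]; nlinarith [Nat.zero_le (r * k)]
      omega
    obtain ⟨G, rfl⟩ := prod_linear_dvd Finset.univ hl hnz hprop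
      fun i _ => linear_dvd_of_order hl hnz hprop hdeg hord i
    have hG := right_ne_zero_of_mul hF
    have hP : (∏ i, ℓ i).totalDegree = n := by
      have := IsHomogeneous.prod Finset.univ ℓ (fun _ => 1) fun i _ => hl i
      simpa using this.totalDegree (left_ne_zero_of_mul hF)
    rw [totalDegree_mul_of_isDomain (left_ne_zero_of_mul hF) hG, hP] at hlt
    have hlow := ih hG fun q hq => by
      have hq' := hord q hq
      by_cases hm : 2 ≤ (Finset.univ.filter fun i => eval q (ℓ i) = 0).card ∧ 1 ≤ r
      · refine X_pow_dvd_expandAt_of_prod_mul Finset.univ hl hnz q _ G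
          ((pow_dvd_pow _ ?_).trans hq')
        generalize (Finset.univ.filter fun i => eval q (ℓ i) = 0).card = m at hm
        obtain ⟨k, rfl⟩ := Nat.exists_eq_add_of_le hm.1
        obtain ⟨t, rfl⟩ := Nat.exists_eq_add_of_le hm.2
        have e1 : 2 * (1 + t) - 1 = 2 * t + 1 := by omega
        have e2 : 2 * (1 + t + 1) - 1 = 2 * t + 3 := by omega
        have e3 : 2 + k - 1 = k + 1 := by omega
        rw [e1, e2, e3]
        nlinarith
      · rw [Nat.mul_eq_zero.mpr (by omega)]
        simp
    have : (r + 1) * n = r * n + n := by ring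
    omega

end Arrangement
/-- Proposition 3.3, odd case: for the fat points ideal `I = ∩ I(P_j)^(n_j - 1)` of a rank-3
arrangement of `n` lines in `ℙ²_K` (char `K = 0`) with singular points `P_j` lying on `n_j`
lines, every nonzero homogeneous element of the symbolic power
`I^(2r-1) = ∩ I(P_j)^((2r-1)(n_j-1))` has degree at least `rn - 1`. -/
theorem stmt8 {K : Type*} [Field K] [CharZero K] (n s : ℕ)
    (ℓ : Fin n → MvPolynomial (Fin 3) K)
    (hl : ∀ i, (ℓ i).IsHomogeneous 1) (hnz : ∀ i, ℓ i ≠ 0)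
    (hprop : ∀ i j, i ≠ j → ∀ c : K, ℓ i ≠ c • ℓ j)
    (hrank : ∀ q : Fin 3 → K, (∀ i, MvPolynomial.eval q (ℓ i) = 0) → q = 0)
    (p : Fin s → (Fin 3 → K)) (hp : ∀ j, p j ≠ 0)
    (hpdist : ∀ j k, j ≠ k → ∀ c : K, p j ≠ c • p k)
    (m : Fin s → ℕ)
    (hm : ∀ j, m j = (Finset.univ.filter
      (fun i => MvPolynomial.eval (p j) (ℓ i) = 0)).card)
    (hsing : ∀ j, 2 ≤ m j)
    (hcomplete : ∀ q : Fin 3 → K, q ≠ 0 →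
      2 ≤ (Finset.univ.filter (fun i => MvPolynomial.eval q (ℓ i) = 0)).card →
      ∃ j, ∃ c : K, q = c • p j)
    (r : ℕ) (hr : 1 ≤ r)
    (F : MvPolynomial (Fin 3) K) (hF : F ≠ 0) (d : ℕ) (hFd : F.IsHomogeneous d)
    (hFmem : F ∈ ⨅ j, pointIdeal (p j) ^ ((2 * r - 1) * (m j - 1))) :
    r * n - 1 ≤ d := by
  have : Infinite K := CharZero.infinite K
  have hprop' : ∀ i j, i ≠ j → ¬ ℓ i ∣ ℓ j := fun i j hij h => by
    obtain ⟨c, hc⟩ := (hl i).exists_eq_smul_of_dvd (hl j) (hnz j) h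
    exact hprop j i hij.symm c hc
  have hn : 2 ≤ n := by
    by_contra! hlt
    have hex : ∃ f : MvPolynomial (Fin 3) K, f.IsHomogeneous 1 ∧ ∀ i, ℓ i = f := by
      have : Subsingleton (Fin n) := Fin.subsingleton_iff_le_one.mpr (by omega)
      rcases isEmpty_or_nonempty (Fin n) with _ | ⟨⟨i⟩⟩
      · exact ⟨0, MvPolynomial.isHomogeneous_zero _ _ _, isEmptyElim⟩
      · exact ⟨ℓ i, hl i, fun j => by rw [Subsingleton.elim j i]⟩
    obtain ⟨f, hf, hlf⟩ := hex
    obtain ⟨v, hv, hv0⟩ := exists_eval_eq_zero_notMem_span hf 0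
    exact hv0 (by simp [hrank v fun i => hlf i ▸ hv])
  rw [← hFd.totalDegree hF]
  refine le_totalDegree_of_order hn hl hnz hprop' r hF fun q hq => ?_
  by_cases h2 : 2 ≤ (Finset.univ.filter fun i => MvPolynomial.eval q (ℓ i) = 0).card
  · obtain ⟨j, c, rfl⟩ := hcomplete q hq h2
    have hc : c ≠ 0 := fun h => hq (by simp [h])
    apply X_pow_dvd_expandAt_of_mem
    have hcard : ∀ i, MvPolynomial.eval (c • p j) (ℓ i) = 0 ↔ MvPolynomial.eval (p j) (ℓ i) = 0 :=
      fun i => by rw [(hl i).eval_smul_of_linear]; simp [hc]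
    simp only [hcard]
    rw [pointIdeal_smul hc, ← hm j]
    exact (Ideal.mem_iInf.mp hFmem) j
  · rw [Nat.mul_eq_zero.mpr (by omega)]
    simp
end

section
/- Let I be the fat points ideal I = ∩_j I(P_j)^{n_j-1} of a rank-3 arrangement of n lines in P^2_K (char K = 0). Then for all r ≥ 1, I^(2r-1) ⊆ M^{r-1}·I^r, where M = ⟨x,y,z⟩. -/
open scoped Classical

namespace MvPolynomial

variable {σ K : Type*} [Field K]

theorem IsHomogeneous.homogeneousComponent_mul {f : MvPolynomial σ K} {i : ℕ}
    (hf : f.IsHomogeneous i) (g : MvPolynomial σ K) (j : ℕ) :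
    homogeneousComponent (i + j) (f * g) = f * homogeneousComponent j g := by
  let _ := MvPolynomial.gradedAlgebra (σ := σ) (R := K)
  have h := DirectSum.coe_decompose_mul_add_of_left_mem (homogeneousSubmodule σ K)
    (j := j) (b := g) ((mem_homogeneousSubmodule i f).2 hf)
  rw [← decomposition.decompose'_apply, ← decomposition.decompose'_apply]
  exact h

theorem IsHomogeneous.exists_eq_sum {f : MvPolynomial (Fin 3) K} (hf : f.IsHomogeneous 1) :
    ∃ c : Fin 3 → K, f = ∑ a, C (c a) * X a := by
  have h : f ∈ homogeneousSubmodule (Fin 3) K 1 := hf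
  rw [homogeneousSubmodule_one_eq_span_X, Submodule.mem_span_range_iff_exists_fun] at h
  obtain ⟨c, rfl⟩ := h
  exact ⟨c, by simp [smul_eq_C_mul]⟩

theorem IsHomogeneous.aeval_C_mul {F : MvPolynomial σ K} {d : ℕ} (hF : F.IsHomogeneous d)
    (P : σ → K) (Z : MvPolynomial σ K) :
    MvPolynomial.aeval (fun a => C (P a) * Z) F = C (eval P F) * Z ^ d := by
  conv_lhs => rw [F.as_sum]
  conv_rhs => rw [F.as_sum]
  rw [map_sum, map_sum, map_sum, Finset.sum_mul]
  refine Finset.sum_congr rfl fun m hm => ?_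
  have hd := hF.degree_eq_sum_deg_support hm
  rw [aeval_monomial, eval_monomial, hd, algebraMap_eq]
  simp only [mul_pow, Finsupp.prod, Finset.prod_mul_distrib, Finset.prod_pow_eq_pow_sum, map_mul,
    map_prod, map_pow]
  ring

theorem IsHomogeneous.mem_pow_idealOfVars {F : MvPolynomial σ K} {d : ℕ}
    (hF : F.IsHomogeneous d) : F ∈ idealOfVars σ K ^ d := by
  rw [mem_pow_idealOfVars_iff']
  intro x hx
  exact hF.coeff_eq_zero hx.ne

/-- A form vanishing at a point lies in the ideal of any two linear forms that span the linear
forms vanishing there. -/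
theorem IsHomogeneous.mem_span_pair_of_eval_eq_zero {F ℓ q : MvPolynomial σ K} {d : ℕ}
    (hF : F.IsHomogeneous d) {P : σ → K} (hP : P ≠ 0)
    (hspan : ∀ f : MvPolynomial σ K, f.IsHomogeneous 1 → eval P f = 0 → f ∈ Ideal.span {ℓ, q})
    (hFP : eval P F = 0) : F ∈ Ideal.span {ℓ, q} := by
  obtain ⟨b, hb⟩ := Function.ne_iff.1 hP
  rw [← Ideal.Quotient.eq_zero_iff_mem]
  set I := Ideal.span {ℓ, q}
  have key : (Ideal.Quotient.mkₐ K I) =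
      (Ideal.Quotient.mkₐ K I).comp (MvPolynomial.aeval fun a => C (P a) * (C (P b)⁻¹ * X b)) := by
    ext a
    rw [AlgHom.comp_apply, aeval_X, Ideal.Quotient.mkₐ_eq_mk, Ideal.Quotient.eq]
    refine hspan _ ?_ ?_
    · rw [← mul_assoc, ← map_mul]
      exact IsHomogeneous.sub (isHomogeneous_X K a) (isHomogeneous_C_mul_X _ _)
    · have : P b ≠ 0 := hb
      simp [this]
  have h := DFunLike.congr_fun key F
  rw [AlgHom.comp_apply, hF.aeval_C_mul, hFP] at h
  simpa using h

theorem IsHomogeneous.exists_eq_mul_add_mul {F ℓ q : MvPolynomial σ K} {d : ℕ}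
    (hF : F.IsHomogeneous (d + 1)) (hl : ℓ.IsHomogeneous 1) (hq : q.IsHomogeneous 1)
    (hmem : F ∈ Ideal.span {ℓ, q}) :
    ∃ A B : MvPolynomial σ K, A.IsHomogeneous d ∧ B.IsHomogeneous d ∧ F = ℓ * A + q * B := by
  obtain ⟨A, B, h⟩ := Ideal.mem_span_pair.1 hmem
  refine ⟨homogeneousComponent d A, homogeneousComponent d B,
    homogeneousComponent_isHomogeneous _ _, homogeneousComponent_isHomogeneous _ _, ?_⟩
  rw [← hl.homogeneousComponent_mul, ← hq.homogeneousComponent_mul, ← map_add, add_comm 1 d,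
    mul_comm ℓ, mul_comm q, h, homogeneousComponent_eq_self hF]

end MvPolynomial

section Linear

open MvPolynomial

variable {K : Type*} [Field K]

theorem eval_sum_C_mul_X (c q : Fin 3 → K) : eval q (∑ a, C (c a) * X a) = c ⬝ᵥ q := by
  simp [dotProduct]

theorem exists_common_zero {f g : MvPolynomial (Fin 3) K} (hf : f.IsHomogeneous 1)
    (hg : g.IsHomogeneous 1) : ∃ q : Fin 3 → K, q ≠ 0 ∧ eval q f = 0 ∧ eval q g = 0 := by
  obtain ⟨u, rfl⟩ := hf.exists_eq_sum
  obtain ⟨v, rfl⟩ := hg.exists_eq_sum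
  have hdet : (Matrix.of ![u, v, 0]).det = 0 :=
    Matrix.det_eq_zero_of_row_eq_zero 2 (by simp)
  obtain ⟨q, hq, h⟩ := Matrix.exists_mulVec_eq_zero_iff.2 hdet
  refine ⟨q, hq, ?_, ?_⟩
  · simpa [eval_sum_C_mul_X, Matrix.mulVec, dotProduct] using congrFun h 0
  · simpa [eval_sum_C_mul_X, Matrix.mulVec, dotProduct] using congrFun h 1

theorem mem_span_pair_of_common_zero {ℓ q f : MvPolynomial (Fin 3) K} (hl : ℓ.IsHomogeneous 1)
    (hq : q.IsHomogeneous 1) (hf : f.IsHomogeneous 1) (hq0 : q ≠ 0) (hlq : ∀ c : K, ℓ ≠ c • q)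
    {P : Fin 3 → K} (hP : P ≠ 0) (hlP : eval P ℓ = 0) (hqP : eval P q = 0)
    (hfP : eval P f = 0) : f ∈ Submodule.span K {ℓ, q} := by
  obtain ⟨u, rfl⟩ := hl.exists_eq_sum
  obtain ⟨v, rfl⟩ := hq.exists_eq_sum
  obtain ⟨w, rfl⟩ := hf.exists_eq_sum
  rw [eval_sum_C_mul_X] at hlP hqP hfP
  have hdet : (Matrix.of ![u, v, w]).det = 0 := by
    refine Matrix.exists_mulVec_eq_zero_iff.1 ⟨P, hP, ?_⟩
    ext a
    fin_cases a <;> simpa [Matrix.mulVec]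
  obtain ⟨t, ht, h⟩ := Matrix.exists_vecMul_eq_zero_iff.2 hdet
  have hrel : t 0 • (∑ a, C (u a) * X a : MvPolynomial (Fin 3) K) + t 1 • (∑ a, C (v a) * X a)
      + t 2 • (∑ a, C (w a) * X a) = 0 := by
    simp only [smul_eq_C_mul, Finset.mul_sum, ← mul_assoc, ← C_mul, ← Finset.sum_add_distrib,
      ← add_mul, ← C_add]
    refine Finset.sum_eq_zero fun a _ => ?_
    have := congrFun h a
    simp [Matrix.vecMul, dotProduct, Fin.sum_univ_three] at this
    simp [this]
  generalize (∑ a, C (u a) * X a : MvPolynomial (Fin 3) K) = ℓ at *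
  generalize (∑ a, C (v a) * X a : MvPolynomial (Fin 3) K) = q at *
  generalize (∑ a, C (w a) * X a : MvPolynomial (Fin 3) K) = f at *
  have h2 : t 2 ≠ 0 := by
    intro h2
    rw [h2, zero_smul, add_zero] at hrel
    have h0 : t 0 = 0 := by
      by_contra h0
      refine hlq (-((t 0)⁻¹ * t 1)) ?_
      rw [neg_smul, mul_smul, eq_neg_of_add_eq_zero_right hrel, smul_neg, neg_neg,
        inv_smul_smul₀ h0]
    rw [h0, zero_smul, zero_add, smul_eq_zero, or_iff_left hq0] at hrel
    apply ht
    ext a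
    fin_cases a <;> simpa
  rw [Submodule.mem_span_pair]
  refine ⟨-((t 2)⁻¹ * t 0), -((t 2)⁻¹ * t 1), ?_⟩
  rw [← inv_smul_smul₀ h2 f, eq_neg_of_add_eq_zero_right hrel]
  module

theorem exists_smul_eq_of_common_zeros {ℓ q : MvPolynomial (Fin 3) K} (hl : ℓ.IsHomogeneous 1)
    (hq : q.IsHomogeneous 1) (hq0 : q ≠ 0) (hlq : ∀ c : K, ℓ ≠ c • q)
    {P Q : Fin 3 → K} (hP : P ≠ 0) (hlP : eval P ℓ = 0) (hqP : eval P q = 0)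
    (hlQ : eval Q ℓ = 0) (hqQ : eval Q q = 0) : ∃ c : K, Q = c • P := by
  obtain ⟨b, hb⟩ := Function.ne_iff.1 hP
  replace hb : P b ≠ 0 := hb
  refine ⟨Q b / P b, funext fun a => ?_⟩
  have hmem := mem_span_pair_of_common_zero hl hq
    (f := C (P b) * X a - C (P a) * X b) ((isHomogeneous_C_mul_X _ _).sub
      (isHomogeneous_C_mul_X _ _)) hq0 hlq hP hlP hqP (by simp; ring)
  obtain ⟨c, d, h⟩ := Submodule.mem_span_pair.1 hmem
  have h' := congrArg (eval Q) h
  simp [hlQ, hqQ, smul_eval] at h'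
  simp only [Pi.smul_apply, smul_eq_mul]
  field_simp
  linear_combination -h'

end Linear

section Taylor

open MvPolynomial

variable {σ K : Type*} [Field K]

/-- The expansion `F (P + T v)` as a polynomial in `T`, where `v` is the vector of variables. -/
noncomputable def taylorAt (P : σ → K) : MvPolynomial σ K →ₐ[K] Polynomial (MvPolynomial σ K) :=
  aeval fun a => Polynomial.C (C (P a)) + Polynomial.X * Polynomial.C (X a)

/-- The expansion `F (P + T w)` as a polynomial in `T`. -/
noncomputable def taylorAlong (P w : σ → K) : MvPolynomial σ K →ₐ[K] Polynomial K :=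
  aeval fun a => Polynomial.C (P a) + Polynomial.X * Polynomial.C (w a)

theorem map_taylorAt (P w : σ → K) (F : MvPolynomial σ K) :
    (taylorAt P F).map (eval w) = taylorAlong P w F := by
  have h : (Polynomial.mapAlgHom (aeval w)).comp (taylorAt P) = taylorAlong P w := by
    ext1 a
    simp [taylorAt, taylorAlong]
  rw [← h]
  simp [Polynomial.mapAlgHom, coe_aeval_eq_eval]

theorem X_pow_dvd_taylorAlong {P w : σ → K} {F : MvPolynomial σ K} {d : ℕ}
    (h : Polynomial.X ^ d ∣ taylorAt P F) : Polynomial.X ^ d ∣ taylorAlong P w F := by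
  rw [← map_taylorAt]
  simpa using map_dvd (Polynomial.mapRingHom (eval w)) h

theorem coeff_zero_taylorAlong (P w : σ → K) (F : MvPolynomial σ K) :
    (taylorAlong P w F).coeff 0 = eval P F := by
  have h : (Polynomial.aeval (0 : K)).comp (taylorAlong P w) = aeval P := by
    ext1 a
    simp [taylorAlong]
  rw [Polynomial.coeff_zero_eq_eval_zero, ← coe_aeval_eq_eval]
  simpa [Polynomial.coe_aeval_eq_eval] using DFunLike.congr_fun h F

theorem MvPolynomial.IsHomogeneous.taylorAt_eq {P : Fin 3 → K} {f : MvPolynomial (Fin 3) K}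
    (hf : f.IsHomogeneous 1) :
    taylorAt P f = Polynomial.C (C (eval P f)) + Polynomial.X * Polynomial.C f := by
  obtain ⟨c, rfl⟩ := hf.exists_eq_sum
  simp only [taylorAt, map_sum, map_mul, aeval_X, eval_C, eval_X, Finset.mul_sum,
    ← Finset.sum_add_distrib]
  refine Finset.sum_congr rfl fun a _ => ?_
  rw [← algebraMap_eq, AlgHom.commutes, Polynomial.algebraMap_apply]
  ring

theorem MvPolynomial.IsHomogeneous.taylorAlong_eq {P w : Fin 3 → K} {f : MvPolynomial (Fin 3) K}
    (hf : f.IsHomogeneous 1) :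
    taylorAlong P w f = Polynomial.C (eval P f) + Polynomial.X * Polynomial.C (eval w f) := by
  rw [← map_taylorAt, hf.taylorAt_eq]
  simp

/-- Elements of the `k`-th power of the ideal of a point vanish there to order at least `k`. -/
theorem X_pow_dvd_taylorAt_of_mem_pow {P : Fin 3 → K} {F : MvPolynomial (Fin 3) K} {k : ℕ}
    (hF : F ∈ pointIdeal P ^ k) : Polynomial.X ^ k ∣ taylorAt P F := by
  have hle : (pointIdeal P).map (taylorAt P) ≤ Ideal.span {Polynomial.X} := by
    rw [pointIdeal, Ideal.map_span, Ideal.span_le]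
    rintro _ ⟨f, ⟨hf, hfP⟩, rfl⟩
    rw [SetLike.mem_coe, Ideal.mem_span_singleton, hf.taylorAt_eq, hfP]
    simp
  have h := Ideal.mem_map_of_mem (taylorAt P) hF
  rw [Ideal.map_pow] at h
  have h' := Ideal.pow_right_mono hle k h
  rwa [Ideal.span_singleton_pow, Ideal.mem_span_singleton] at h'

end Taylor

section Arrangement

open MvPolynomial

variable {K : Type*} [Field K] {n s : ℕ}

/-- The points `p j` are the singular points, without repetition, of the arrangement of the
distinct and not all concurrent lines `ℓ i = 0`. -/
structure IsSingularLocus (ℓ : Fin n → MvPolynomial (Fin 3) K) (p : Fin s → Fin 3 → K) :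
    Prop where
  isHomogeneous : ∀ i, (ℓ i).IsHomogeneous 1
  ne_zero : ∀ i, ℓ i ≠ 0
  point_ne_zero : ∀ j, p j ≠ 0
  mem_span : ∀ {i k j}, i ≠ k → eval (p j) (ℓ i) = 0 → eval (p j) (ℓ k) = 0 →
    ∀ f : MvPolynomial (Fin 3) K, f.IsHomogeneous 1 → eval (p j) f = 0 →
      f ∈ Ideal.span {ℓ i, ℓ k}
  exists_point : ∀ {i k}, i ≠ k → ∃ j, eval (p j) (ℓ i) = 0 ∧ eval (p j) (ℓ k) = 0
  point_unique : ∀ {i k j j'}, i ≠ k → eval (p j) (ℓ i) = 0 → eval (p j) (ℓ k) = 0 →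
    eval (p j') (ℓ i) = 0 → eval (p j') (ℓ k) = 0 → j = j'
  exists_not_through : ∀ j, ∃ i, eval (p j) (ℓ i) ≠ 0

/-- The lines through `p j` other than the `i`-th one. -/
noncomputable def othersThrough (ℓ : Fin n → MvPolynomial (Fin 3) K) (p : Fin s → Fin 3 → K)
    (i : Fin n) (j : Fin s) : Finset (Fin n) :=
  Finset.univ.filter fun k => k ≠ i ∧ eval (p j) (ℓ k) = 0

/-- The ideal generated by the products of `D` of the linear forms other than the `i`-th one,
in which the `k`-th form occurs at most `b k` times. -/
noncomputable def boundedProducts (ℓ : Fin n → MvPolynomial (Fin 3) K) (i : Fin n) (b : Fin n → ℕ)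
    (D : ℕ) :
    Ideal (MvPolynomial (Fin 3) K) :=
  Ideal.span {g | ∃ v : Fin n → ℕ, v ≤ b ∧ v i = 0 ∧ ∑ k, v k = D ∧ g = ∏ k, ℓ k ^ v k}

variable {ℓ : Fin n → MvPolynomial (Fin 3) K} {p : Fin s → Fin 3 → K}

theorem mem_othersThrough {i k : Fin n} {j : Fin s} :
    k ∈ othersThrough ℓ p i j ↔ k ≠ i ∧ eval (p j) (ℓ k) = 0 := by
  simp [othersThrough]

theorem mul_mem_mul_boundedProducts {i k : Fin n} (hk : k ≠ i) {b : Fin n → ℕ} {D : ℕ}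
    {𝔞 : Ideal (MvPolynomial (Fin 3) K)} {x : MvPolynomial (Fin 3) K}
    (hx : x ∈ 𝔞 * boundedProducts ℓ i b D) :
    ℓ k * x ∈ 𝔞 * boundedProducts ℓ i (b + Pi.single k 1) (D + 1) := by
  have h : Ideal.span {ℓ k} * boundedProducts ℓ i b D ≤
      boundedProducts ℓ i (b + Pi.single k 1) (D + 1) := by
    rw [boundedProducts, Ideal.span_mul_span', Ideal.span_le]
    rintro _ ⟨_, rfl, _, ⟨v, hv, hvi, rfl, rfl⟩, rfl⟩
    refine Ideal.subset_span ⟨v + Pi.single k 1, by gcongr, by simp [hvi, hk.symm], ?_, ?_⟩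
    · simp [Finset.sum_add_distrib]
    · simp only [Pi.add_apply, pow_add, Finset.prod_mul_distrib]
      rw [mul_comm]
      congr 1
      rw [Finset.prod_eq_single k (fun k' _ hk' => by simp [hk']) (by simp)]
      simp
  have h' := Ideal.mul_mono_right (I := 𝔞) h
  apply h'
  rw [mul_left_comm]
  exact Ideal.mul_mem_mul (Ideal.mem_span_singleton_self _) hx

namespace IsSingularLocus

variable (h : IsSingularLocus ℓ p)
include h

theorem exists_direction (i : Fin n) : ∃ w : Fin s → Fin 3 → K, ∀ j, eval (p j) (ℓ i) = 0 →
    eval (w j) (ℓ i) = 0 ∧ ∀ k ∈ othersThrough ℓ p i j, eval (w j) (ℓ k) ≠ 0 := by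
  have key : ∀ j, ∃ w : Fin 3 → K, eval (p j) (ℓ i) = 0 →
      eval w (ℓ i) = 0 ∧ ∀ k ∈ othersThrough ℓ p i j, eval w (ℓ k) ≠ 0 := by
    intro j
    by_cases hij : eval (p j) (ℓ i) = 0
    · obtain ⟨k, hk⟩ := h.exists_not_through j
      have hik : i ≠ k := by rintro rfl; exact hk hij
      obtain ⟨j', hij', hkj'⟩ := h.exists_point hik
      refine ⟨p j', fun _ => ⟨hij', fun k' hk' hw => hk ?_⟩⟩
      rw [mem_othersThrough] at hk'
      rwa [h.point_unique hk'.1.symm hij hk'.2 hij' hw]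
    · exact ⟨0, fun h0 => absurd h0 hij⟩
  choose w hw using key
  exact ⟨w, hw⟩

theorem mem_span_of_eval_eq_zero {i k : Fin n} {j : Fin s} (hij : eval (p j) (ℓ i) = 0)
    (hk : k ∈ othersThrough ℓ p i j) {F : MvPolynomial (Fin 3) K} {d : ℕ}
    (hF : F.IsHomogeneous d) (hFj : eval (p j) F = 0) : F ∈ Ideal.span {ℓ i, ℓ k} :=
  hF.mem_span_pair_of_eval_eq_zero (h.point_ne_zero j)
    (h.mem_span (mem_othersThrough.1 hk).1.symm hij (mem_othersThrough.1 hk).2) hFj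

variable {i : Fin n} {w : Fin s → Fin 3 → K}
  (hw : ∀ j, eval (p j) (ℓ i) = 0 →
    eval (w j) (ℓ i) = 0 ∧ ∀ k ∈ othersThrough ℓ p i j, eval (w j) (ℓ k) ≠ 0)
include hw

theorem exists_peel {j : Fin s} (hij : eval (p j) (ℓ i) = 0) {k : Fin n}
    (hk : k ∈ othersThrough ℓ p i j) {F : MvPolynomial (Fin 3) K} {d : ℕ}
    (hF : F.IsHomogeneous (d + 1)) (hFj : eval (p j) F = 0) :
    ∃ A B : MvPolynomial (Fin 3) K, A.IsHomogeneous d ∧ B.IsHomogeneous d ∧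
      F = ℓ i * A + ℓ k * B ∧ ∀ j', eval (p j') (ℓ i) = 0 → ∀ μ : ℕ,
        Polynomial.X ^ μ ∣ taylorAlong (p j') (w j') F →
        Polynomial.X ^ (if j' = j then μ - 1 else μ) ∣ taylorAlong (p j') (w j') B := by
  obtain ⟨A, B, hA, hB, rfl⟩ := hF.exists_eq_mul_add_mul (h.isHomogeneous i) (h.isHomogeneous k)
    (h.mem_span_of_eval_eq_zero hij hk hF hFj)
  refine ⟨A, B, hA, hB, rfl, fun j' hij' μ hμ => ?_⟩
  rw [map_add, map_mul, (h.isHomogeneous i).taylorAlong_eq, hij', (hw j' hij').1, map_mul] at hμ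
  simp only [map_zero, mul_zero, add_zero, zero_mul, zero_add] at hμ
  rw [(h.isHomogeneous k).taylorAlong_eq] at hμ
  have hk' := mem_othersThrough.1 hk
  split_ifs with hj
  · subst hj
    rw [hk'.2, map_zero, zero_add, mul_assoc] at hμ
    rcases μ with _ | μ
    · simp
    · rw [pow_succ', mul_dvd_mul_iff_left Polynomial.X_ne_zero] at hμ
      refine Polynomial.prime_X.pow_dvd_of_dvd_mul_left _ ?_ hμ
      rw [Polynomial.X_dvd_iff]
      simpa using (hw j' hij').2 k hk
  · refine Polynomial.prime_X.pow_dvd_of_dvd_mul_left _ ?_ hμ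
    rw [Polynomial.X_dvd_iff]
    intro h0
    simp at h0
    exact hj (h.point_unique hk'.1.symm hij' h0 hij hk'.2)

omit hw in
theorem notMem_othersThrough {j j' : Fin s} (hij : eval (p j) (ℓ i) = 0)
    (hij' : eval (p j') (ℓ i) = 0) (hne : j' ≠ j) {k : Fin n} (hk : k ∈ othersThrough ℓ p i j) :
    k ∉ othersThrough ℓ p i j' := by
  intro hk'
  rw [mem_othersThrough] at hk hk'
  exact hne (h.point_unique hk.1.symm hij' hk'.2 hij hk.2)

/-- A form whose prescribed vanishing on the points of a line exceeds its degree is divisible by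
the equation of that line. -/
theorem dvd_of_lt_sum (hnonempty : ∀ j, eval (p j) (ℓ i) = 0 → (othersThrough ℓ p i j).Nonempty)
    {d : ℕ} {μ : Fin s → ℕ} {F : MvPolynomial (Fin 3) K} (hF : F.IsHomogeneous d)
    (hμ : ∀ j, eval (p j) (ℓ i) = 0 → Polynomial.X ^ μ j ∣ taylorAlong (p j) (w j) F)
    (hd : d < ∑ j with eval (p j) (ℓ i) = 0, μ j) : ℓ i ∣ F := by
  induction d generalizing μ F with
  | zero =>
    obtain ⟨j, hj, hj0⟩ := Finset.exists_ne_zero_of_sum_ne_zero hd.ne'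
    have hij := (Finset.mem_filter.1 hj).2
    have hFj := (Polynomial.X_dvd_iff.1 ((dvd_pow_self _ hj0).trans (hμ j hij)))
    rw [coeff_zero_taylorAlong] at hFj
    rw [← totalDegree_zero_iff_isHomogeneous, totalDegree_eq_zero_iff_eq_C] at hF
    rw [hF, eval_C] at hFj
    rw [hF, hFj, map_zero]
    exact dvd_zero _
  | succ d ih =>
    obtain ⟨j, hj, hj0⟩ := Finset.exists_ne_zero_of_sum_ne_zero (Nat.ne_zero_of_lt hd)
    have hij := (Finset.mem_filter.1 hj).2
    have hFj := (Polynomial.X_dvd_iff.1 ((dvd_pow_self _ hj0).trans (hμ j hij)))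
    rw [coeff_zero_taylorAlong] at hFj
    obtain ⟨k, hk⟩ := hnonempty j hij
    obtain ⟨A, B, -, hB, rfl, hBμ⟩ := h.exists_peel hw hij hk hF hFj
    refine dvd_add (dvd_mul_right _ _) (Dvd.dvd.mul_left (ih hB
      (μ := fun j' => if j' = j then μ j' - 1 else μ j') (fun j' hij' => hBμ j' hij' _ (hμ j' hij'))
      ?_) _)
    have hsum := Finset.add_sum_erase _ μ hj
    rw [← Finset.add_sum_erase _ _ hj, if_pos rfl,
      Finset.sum_congr rfl fun j' hj' => if_neg (Finset.ne_of_mem_erase hj')]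
    lia

theorem exists_mul_add_mem_mul_boundedProducts {E e D : ℕ} {b : Fin n → ℕ}
    (hb : ∑ k ∈ Finset.univ.erase i, b k = D + e)
    {F : MvPolynomial (Fin 3) K} (hF : F.IsHomogeneous (E + D))
    (hμ : ∀ j, eval (p j) (ℓ i) = 0 →
      Polynomial.X ^ (∑ k ∈ othersThrough ℓ p i j, b k - e) ∣ taylorAlong (p j) (w j) F) :
    ∃ A B : MvPolynomial (Fin 3) K, F = ℓ i * A + B ∧ (ℓ i * A).IsHomogeneous (E + D) ∧
      B ∈ idealOfVars (Fin 3) K ^ E * boundedProducts ℓ i b D := by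
  induction D generalizing b F with
  | zero =>
    refine ⟨0, F, by simp, by simpa using isHomogeneous_zero _ _ _, ?_⟩
    have h1 : boundedProducts ℓ i b 0 = ⊤ := by
      rw [Ideal.eq_top_iff_one]
      exact Ideal.subset_span ⟨0, fun _ => Nat.zero_le _, rfl, by simp, by simp⟩
    rw [h1, Ideal.mul_top]
    exact hF.mem_pow_idealOfVars
  | succ D ih =>
    have split : ∀ k, b k ≠ 0 → ∃ b' : Fin n → ℕ, b = b' + Pi.single k 1 := fun k hk =>
      ⟨b - Pi.single k 1, (tsub_add_cancel_of_le fun k' => by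
        rcases eq_or_ne k' k with rfl | hk'
        · simpa using Nat.one_le_iff_ne_zero.2 hk
        · simp [hk']).symm⟩
    by_cases hbig : ∃ j, eval (p j) (ℓ i) = 0 ∧ e < ∑ k ∈ othersThrough ℓ p i j, b k
    · obtain ⟨j, hij, hj⟩ := hbig
      have hFj := Polynomial.X_dvd_iff.1
        ((dvd_pow_self _ (Nat.sub_ne_zero_of_lt hj)).trans (hμ j hij))
      rw [coeff_zero_taylorAlong] at hFj
      obtain ⟨k, hk, hbk⟩ := Finset.exists_ne_zero_of_sum_ne_zero (Nat.ne_zero_of_lt hj)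
      have hki := (mem_othersThrough.1 hk).1
      obtain ⟨b, rfl⟩ := split k hbk
      obtain ⟨A, B, hA, hB, rfl, hBμ⟩ := h.exists_peel hw hij hk hF hFj
      simp only [Pi.add_apply, Finset.sum_add_distrib, Finset.sum_pi_single'] at hb hμ
      rw [if_pos (by simp [hki])] at hb
      obtain ⟨A', B', rfl, hA', hB'⟩ := ih (b := b) (by omega) hB (fun j' hij' => by
        have := hBμ j' hij' _ (hμ j' hij')
        split_ifs at this with h1 h2 h2
        · convert this using 2; omega
        · exact absurd (h1 ▸ hk) h2
        · exact absurd h2 (h.notMem_othersThrough hij hij' h1 hk)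
        · simpa using this)
      refine ⟨A + ℓ k * A', ℓ k * B', by ring, ?_, mul_mem_mul_boundedProducts hki hB'⟩
      rw [mul_add, mul_left_comm]
      refine IsHomogeneous.add ?_ ?_
      · rw [← add_assoc, add_comm]
        exact (h.isHomogeneous i).mul hA
      · rw [← add_assoc, add_comm]
        exact (h.isHomogeneous k).mul hA'
    · push Not at hbig
      have ih' : ∀ (b' : Fin n → ℕ) (G : MvPolynomial (Fin 3) K) (k : Fin n), k ≠ i →
          b = b' + Pi.single k 1 → G.IsHomogeneous (E + D) →
          ∃ A B, ℓ k * G = ℓ i * A + B ∧ (ℓ i * A).IsHomogeneous (E + (D + 1)) ∧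
          B ∈ idealOfVars (Fin 3) K ^ E * boundedProducts ℓ i b (D + 1) := by
        rintro b' G k hki rfl hG
        obtain ⟨A, B, rfl, hA, hB⟩ := ih (b := b') (by
          simp only [Pi.add_apply, Finset.sum_add_distrib, Finset.sum_pi_single'] at hb
          rw [if_pos (by simp [hki])] at hb
          omega) hG (fun j hij => by
          have := hbig j hij
          simp only [Pi.add_apply, Finset.sum_add_distrib] at this
          rw [Nat.sub_eq_zero_of_le (by omega), pow_zero]
          exact one_dvd _)
        refine ⟨ℓ k * A, ℓ k * B, by ring, ?_, mul_mem_mul_boundedProducts hki hB⟩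
        rw [mul_left_comm, ← add_assoc, add_comm]
        exact (h.isHomogeneous k).mul hA
      obtain ⟨k₁, hk₁, hbk₁⟩ := Finset.exists_ne_zero_of_sum_ne_zero
        (s := Finset.univ.erase i) (f := b) (by omega)
      have hk₁i := Finset.ne_of_mem_erase hk₁
      obtain ⟨j, hij, hk₁j⟩ := h.exists_point hk₁i.symm
      obtain ⟨k₂, hk₂i, hk₂j, hbk₂⟩ : ∃ k, k ≠ i ∧ eval (p j) (ℓ k) ≠ 0 ∧ b k ≠ 0 := by
        by_contra! hcon
        have : ∑ k ∈ othersThrough ℓ p i j, b k = ∑ k ∈ Finset.univ.erase i, b k := by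
          refine Finset.sum_subset (fun k hk => by simpa using (mem_othersThrough.1 hk).1) ?_
          intro k hk hkn
          have hki := Finset.ne_of_mem_erase hk
          exact hcon k hki fun h0 => hkn (mem_othersThrough.2 ⟨hki, h0⟩)
        have := hbig j hij
        omega
      obtain ⟨b₁, hb₁⟩ := split k₁ hbk₁
      obtain ⟨b₂, hb₂⟩ := split k₂ hbk₂
      set c := eval (p j) F / eval (p j) (ℓ k₂) ^ (E + D + 1) with hc
      have hpow : (ℓ k₂ ^ (E + D)).IsHomogeneous (E + D) := by
        simpa using (h.isHomogeneous k₂).pow (E + D)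
      have hcpow : (C c * ℓ k₂ ^ (E + D + 1)).IsHomogeneous (E + D + 1) := by
        simpa using ((h.isHomogeneous k₂).pow (E + D + 1)).C_mul c
      obtain ⟨A, B, hA, hB, hAB, -⟩ := h.exists_peel hw hij
        (mem_othersThrough.2 ⟨hk₁i, hk₁j⟩) (IsHomogeneous.sub hF hcpow) (by
          rw [map_sub, map_mul, map_pow, eval_C, hc, div_mul_cancel₀, sub_self]
          exact pow_ne_zero _ hk₂j)
      obtain ⟨A₁, B₁, h₁, hA₁, hB₁⟩ := ih' b₁ B k₁ hk₁i hb₁ hB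
      obtain ⟨A₂, B₂, h₂, hA₂, hB₂⟩ := ih' b₂ (C c * ℓ k₂ ^ (E + D)) k₂ hk₂i hb₂ (hpow.C_mul c)
      refine ⟨A + A₁ + A₂, B₁ + B₂, ?_, ?_, Ideal.add_mem _ hB₁ hB₂⟩
      · rw [sub_eq_iff_eq_add] at hAB
        rw [hAB]
        linear_combination h₁ + h₂
      · rw [mul_add, mul_add]
        refine IsHomogeneous.add (IsHomogeneous.add ?_ hA₁) hA₂
        rw [← add_assoc, add_comm]
        exact (h.isHomogeneous i).mul hA

omit hw

theorem X_pow_dvd_taylorAt_of_pow_mul (k : Fin n) (j : Fin s) {R m : ℕ}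
    {F : MvPolynomial (Fin 3) K}
    (hF : Polynomial.X ^ R ∣ taylorAt (p j) (ℓ k ^ m * F)) :
    Polynomial.X ^ (R - if eval (p j) (ℓ k) = 0 then m else 0) ∣ taylorAt (p j) F := by
  rw [map_mul, map_pow, (h.isHomogeneous k).taylorAt_eq] at hF
  split_ifs with hkj
  · rcases le_total R m with hRm | hRm
    · simp [Nat.sub_eq_zero_of_le hRm]
    · obtain ⟨t, rfl⟩ := Nat.exists_eq_add_of_le hRm
      rw [hkj, map_zero, map_zero, zero_add, mul_pow, mul_assoc, pow_add,
        mul_dvd_mul_iff_left (pow_ne_zero _ Polynomial.X_ne_zero)] at hF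
      rw [Nat.add_sub_cancel_left]
      refine Polynomial.prime_X.pow_dvd_of_dvd_mul_left _ (fun hX => ?_) hF
      have := Polynomial.X_dvd_iff.1 (Polynomial.prime_X.dvd_of_dvd_pow hX)
      exact h.ne_zero k (by simpa using this)
  · refine Polynomial.prime_X.pow_dvd_of_dvd_mul_left _ (fun hX => ?_) hF
    have := Polynomial.X_dvd_iff.1 (Polynomial.prime_X.dvd_of_dvd_pow hX)
    exact hkj (by simpa using this)

theorem X_pow_dvd_taylorAt_of_prod_mul (S : Finset (Fin n)) (j : Fin s) (a : Fin n → ℕ) {R : ℕ}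
    {F : MvPolynomial (Fin 3) K}
    (hF : Polynomial.X ^ R ∣ taylorAt (p j) ((∏ k ∈ S, ℓ k ^ a k) * F)) :
    Polynomial.X ^ (R - ∑ k ∈ S with eval (p j) (ℓ k) = 0, a k) ∣ taylorAt (p j) F := by
  induction S using Finset.induction_on generalizing R with
  | empty => simpa using hF
  | insert k S hk ih =>
    rw [Finset.prod_insert hk, mul_assoc] at hF
    have := ih (h.X_pow_dvd_taylorAt_of_pow_mul k j hF)
    rw [Finset.sum_filter] at this ⊢
    rwa [Finset.sum_insert hk, ← Nat.sub_sub]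

omit h in
theorem filter_eq_insert_othersThrough {i : Fin n} {j : Fin s} (hij : eval (p j) (ℓ i) = 0) :
    Finset.univ.filter (fun k => eval (p j) (ℓ k) = 0) = insert i (othersThrough ℓ p i j) := by
  ext k
  rw [Finset.mem_insert, mem_othersThrough, Finset.mem_filter]
  constructor
  · intro hk
    by_cases hki : k = i
    · exact Or.inl hki
    · exact Or.inr ⟨hki, hk.2⟩
  · rintro (rfl | hk)
    · exact ⟨Finset.mem_univ _, hij⟩
    · exact ⟨Finset.mem_univ _, hk.2⟩

omit h in
theorem sum_through {i : Fin n} {j : Fin s} (hij : eval (p j) (ℓ i) = 0) (a : Fin n → ℕ) :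
    ∑ k with eval (p j) (ℓ k) = 0, a k = a i + ∑ k ∈ othersThrough ℓ p i j, a k := by
  rw [filter_eq_insert_othersThrough hij, Finset.sum_insert]
  simp [mem_othersThrough]

/-- The points on a line partition the other lines. -/
theorem sum_sum_othersThrough (i : Fin n) (a : Fin n → ℕ) :
    ∑ j with eval (p j) (ℓ i) = 0, ∑ k ∈ othersThrough ℓ p i j, a k =
      ∑ k ∈ Finset.univ.erase i, a k := by
  rw [← Finset.sum_biUnion]
  · refine Finset.sum_congr ?_ fun _ _ => rfl
    ext k
    simp only [Finset.mem_biUnion, Finset.mem_filter, Finset.mem_univ, true_and,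
      mem_othersThrough, Finset.mem_erase, and_true]
    constructor
    · rintro ⟨j, -, hk, -⟩
      exact hk
    · intro hk
      obtain ⟨j, hj, hj'⟩ := h.exists_point (Ne.symm hk)
      exact ⟨j, hj, hk, hj'⟩
  · intro j hj j' hj' hne
    refine Finset.disjoint_left.2 fun k hk => ?_
    simp only [Finset.coe_filter, Finset.mem_univ, true_and, Set.mem_ofPred_eq] at hj hj'
    exact h.notMem_othersThrough hj hj' hne.symm hk

omit h in
theorem prod_pow_add_single (i : Fin n) (a : Fin n → ℕ) :
    ∏ k, ℓ k ^ (a + Pi.single i 1 : Fin n → ℕ) k = (∏ k, ℓ k ^ a k) * ℓ i := by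
  simp only [Pi.add_apply, pow_add, Finset.prod_mul_distrib]
  congr 1
  rw [Finset.prod_eq_single i (fun k' _ hk' => by simp [hk']) (by simp)]
  simp

omit h in
theorem add_single_le {a : Fin n → ℕ} {r : ℕ} (ha : ∀ k, a k ≤ r) {i : Fin n} (hi : a i < r)
    (k : Fin n) : (a + Pi.single i 1 : Fin n → ℕ) k ≤ r := by
  rcases eq_or_ne k i with rfl | hk
  · simpa using hi
  · simpa [hk] using ha k

theorem exists_isHomogeneous_of_dvd {i : Fin n} {F : MvPolynomial (Fin 3) K} {d : ℕ}
    (hF : F.IsHomogeneous d) (hF0 : F ≠ 0) (hdvd : ℓ i ∣ F) :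
    ∃ d' A, d = d' + 1 ∧ A.IsHomogeneous d' ∧ F = ℓ i * A := by
  obtain ⟨A, rfl⟩ := hdvd
  have hA0 : A ≠ 0 := right_ne_zero_of_mul hF0
  have hdeg : d = A.totalDegree + 1 := by
    rw [← hF.totalDegree hF0, totalDegree_mul_of_isDomain (h.ne_zero i) hA0,
      (h.isHomogeneous i).totalDegree (h.ne_zero i), add_comm]
  subst hdeg
  refine ⟨_, homogeneousComponent A.totalDegree A, rfl, homogeneousComponent_isHomogeneous _ _, ?_⟩
  rw [← (h.isHomogeneous i).homogeneousComponent_mul, add_comm, homogeneousComponent_eq_self hF]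

variable {o : Fin s → ℕ} (ho : ∀ j, (Finset.univ.filter
  (fun i => eval (p j) (ℓ i) = 0)).card = o j + 1)
include ho

omit h in
theorem card_othersThrough {i : Fin n} {j : Fin s} (hij : eval (p j) (ℓ i) = 0) :
    (othersThrough ℓ p i j).card = o j := by
  have := ho j
  rw [filter_eq_insert_othersThrough hij, Finset.card_insert_of_notMem] at this
  · omega
  · simp [mem_othersThrough]

theorem sum_order (i : Fin n) : ∑ j with eval (p j) (ℓ i) = 0, o j = n - 1 := by
  have := h.sum_sum_othersThrough i fun _ => 1
  simp only [Finset.sum_const, smul_eq_mul, mul_one] at this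
  rw [Finset.card_erase_of_mem (Finset.mem_univ _), Finset.card_univ, Fintype.card_fin] at this
  rw [← this]
  exact Finset.sum_congr rfl fun j hj => (card_othersThrough ho (Finset.mem_filter.1 hj).2).symm

/-- Forms in the `(2r-1)`-st symbolic power have degree at least `rn - 1`. -/
theorem eq_zero_of_degree_lt (ho1 : ∀ j, 1 ≤ o j) (hn : 2 ≤ n) {r d : ℕ} {a : Fin n → ℕ}
    (ha : ∀ k, a k ≤ r) (hd : ∑ k, a k + d + 1 < r * n) {F : MvPolynomial (Fin 3) K}
    (hF : F.IsHomogeneous d)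
    (hμ : ∀ j, Polynomial.X ^ ((2 * r - 1) * o j) ∣ taylorAt (p j) ((∏ k, ℓ k ^ a k) * F)) :
    F = 0 := by
  induction d using Nat.strong_induction_on generalizing a F with
  | _ d ih =>
  by_contra hF0
  obtain ⟨i, -, hi⟩ : ∃ i ∈ Finset.univ, a i < r := Finset.exists_lt_of_sum_lt (by
    simp only [Finset.sum_const, Finset.card_univ, Fintype.card_fin, smul_eq_mul]
    rw [mul_comm n]
    omega)
  obtain ⟨w, hw⟩ := h.exists_direction i
  have hcount : d < ∑ j with eval (p j) (ℓ i) = 0,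
      ((2 * r - 1) * o j - ∑ k with eval (p j) (ℓ k) = 0, a k) := by
    have hpt : ∑ j with eval (p j) (ℓ i) = 0, (2 * r - 1 - a i) * o j ≤
        ∑ j with eval (p j) (ℓ i) = 0, (((2 * r - 1) * o j -
          ∑ k with eval (p j) (ℓ k) = 0, a k) + ∑ k ∈ othersThrough ℓ p i j, a k) := by
      refine Finset.sum_le_sum fun j hj => ?_
      rw [sum_through (Finset.mem_filter.1 hj).2, Nat.sub_mul]
      have := Nat.le_mul_of_pos_right (a i) (ho1 j)
      omega
    rw [Finset.sum_add_distrib, h.sum_sum_othersThrough, ← Finset.mul_sum, h.sum_order ho] at hpt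
    have hsum := Finset.add_sum_erase _ a (Finset.mem_univ i)
    obtain ⟨t, rfl⟩ : ∃ t, r = a i + t + 1 := ⟨r - a i - 1, by omega⟩
    obtain ⟨n', hn'⟩ : ∃ n', n = n' + 2 := ⟨n - 2, by omega⟩
    have e1 : 2 * (a i + t + 1) - 1 - a i = a i + 2 * t + 1 := by omega
    have e2 : n - 1 = n' + 1 := by omega
    rw [e1, e2] at hpt
    rw [show (a i + t + 1) * n = (a i + t + 1) * (n' + 2) by rw [hn']] at hd
    nlinarith [Nat.zero_le (t * n')]
  obtain ⟨d', A, rfl, hA, rfl⟩ := h.exists_isHomogeneous_of_dvd hF hF0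
    (h.dvd_of_lt_sum hw (fun j hij => by
      rw [← Finset.card_pos, card_othersThrough ho hij]
      exact ho1 j) hF
      (fun j _ => X_pow_dvd_taylorAlong (h.X_pow_dvd_taylorAt_of_prod_mul _ j a (hμ j))) hcount)
  refine right_ne_zero_of_mul hF0 (ih d' (Nat.lt_succ_self _) (add_single_le ha hi) ?_ hA ?_)
  · simp only [Pi.add_apply, Finset.sum_add_distrib, Finset.sum_pi_single', Finset.mem_univ,
      if_true]
    omega
  · intro j
    rw [prod_pow_add_single, mul_assoc]
    exact hμ j

theorem prod_erase_mem (k : Fin n) :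
    ∏ l ∈ Finset.univ.erase k, ℓ l ∈ ⨅ j, pointIdeal (p j) ^ o j := by
  rw [Ideal.mem_iInf]
  intro j
  set T := (Finset.univ.filter fun l => eval (p j) (ℓ l) = 0).erase k with hT
  have hTle : T ⊆ Finset.univ.erase k := Finset.erase_subset_erase _ (Finset.filter_subset _ _)
  have hcard : o j ≤ T.card := by
    have := Finset.pred_card_le_card_erase (s := Finset.univ.filter fun l => eval (p j) (ℓ l) = 0)
      (a := k)
    rw [ho j] at this
    exact this
  refine Ideal.mem_of_dvd _ (Finset.prod_dvd_prod_of_subset _ _ ℓ hTle)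
    (Ideal.pow_le_pow_right hcard ?_)
  rw [← Finset.prod_const]
  exact Ideal.prod_mem_prod fun l hl => Ideal.subset_span
    ⟨h.isHomogeneous l, (Finset.mem_filter.1 (Finset.mem_of_mem_erase hl)).2⟩

theorem prod_pow_mem {r : ℕ} {a : Fin n → ℕ} (ha : ∀ k, a k ≤ r)
    (hsum : ∑ k, a k = r * (n - 1)) (hn : 1 ≤ n) :
    ∏ k, ℓ k ^ a k ∈ (⨅ j, pointIdeal (p j) ^ o j) ^ r := by
  have hsub : ∑ k, (r - a k) = r := by
    have : ∑ k, (r - a k) + ∑ k, a k = r * n := by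
      rw [← Finset.sum_add_distrib, Finset.sum_congr rfl fun k _ => Nat.sub_add_cancel (ha k)]
      simp [mul_comm]
    obtain ⟨n', rfl⟩ := Nat.exists_eq_add_of_le' hn
    rw [hsum, Nat.add_sub_cancel, mul_add, mul_one] at this
    omega
  have hprod : ∏ k, ℓ k ^ a k = ∏ k, (∏ l ∈ Finset.univ.erase k, ℓ l) ^ (r - a k) := by
    simp only [← Finset.prod_pow]
    rw [Finset.prod_comm' (t' := Finset.univ) (s' := fun l => Finset.univ.erase l)
      (by simp [eq_comm])]
    refine Finset.prod_congr rfl fun l _ => ?_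
    rw [Finset.prod_pow_eq_pow_sum]
    have hl : r - a l + ∑ k ∈ Finset.univ.erase l, (r - a k) = ∑ k, (r - a k) :=
      Finset.add_sum_erase _ (fun k => r - a k) (Finset.mem_univ l)
    have := ha l
    congr 1
    omega
  rw [hprod, ← hsub, ← Finset.prod_pow_eq_pow_sum, hsub]
  exact Ideal.prod_mem_prod fun k _ => Ideal.pow_mem_pow (h.prod_erase_mem ho k) _

omit h ho in
theorem X_pow_dvd_taylorAt_of_mem {r : ℕ} {F : MvPolynomial (Fin 3) K}
    (hF : F ∈ (⨅ j, pointIdeal (p j) ^ o j) ^ r) (j : Fin s) :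
    Polynomial.X ^ (r * o j) ∣ taylorAt (p j) F := by
  refine X_pow_dvd_taylorAt_of_mem_pow ?_
  rw [mul_comm, pow_mul]
  exact Ideal.pow_right_mono (iInf_le _ j) r hF

/-- Forms of degree at least `r(n-1)` in the `r`-th symbolic power lie in the ordinary power. -/
theorem mem_pow_of_X_pow_dvd {r E D : ℕ} {a : Fin n → ℕ} (hn : 1 ≤ n) (ha : ∀ k, a k ≤ r)
    (hD : ∑ k, a k + D = r * (n - 1)) {F : MvPolynomial (Fin 3) K}
    (hF : F.IsHomogeneous (E + D))
    (hμ : ∀ j, Polynomial.X ^ (r * o j) ∣ taylorAt (p j) ((∏ k, ℓ k ^ a k) * F)) :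
    (∏ k, ℓ k ^ a k) * F ∈ idealOfVars (Fin 3) K ^ E * (⨅ j, pointIdeal (p j) ^ o j) ^ r := by
  induction D generalizing a F with
  | zero =>
    rw [mul_comm (∏ k, ℓ k ^ a k)]
    exact Ideal.mul_mem_mul hF.mem_pow_idealOfVars (h.prod_pow_mem ho ha hD hn)
  | succ D ih =>
    obtain ⟨i, -, hi⟩ : ∃ i ∈ Finset.univ, a i < r := Finset.exists_lt_of_sum_lt (by
      have := Nat.mul_le_mul_left r (Nat.sub_le n 1)
      simp only [Finset.sum_const, Finset.card_univ, Fintype.card_fin, smul_eq_mul]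
      rw [mul_comm n]
      omega)
    obtain ⟨w, hw⟩ := h.exists_direction i
    have hcompl : ∀ S : Finset (Fin n), ∑ k ∈ S, (r - a k) + ∑ k ∈ S, a k = r * S.card := by
      intro S
      rw [← Finset.sum_add_distrib, Finset.sum_congr rfl fun k _ => Nat.sub_add_cancel (ha k)]
      simp [mul_comm]
    obtain ⟨A, B, rfl, hA, hB⟩ := h.exists_mul_add_mem_mul_boundedProducts hw (e := a i)
      (D := D + 1) (b := fun k => r - a k) (by
        have h1 := hcompl (Finset.univ.erase i)
        rw [Finset.card_erase_of_mem (Finset.mem_univ _), Finset.card_univ,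
          Fintype.card_fin] at h1
        have h2 := Finset.add_sum_erase _ a (Finset.mem_univ i)
        omega) hF (fun j hij => by
        have h1 := hcompl (othersThrough ℓ p i j)
        rw [card_othersThrough ho hij] at h1
        have h2 := h.X_pow_dvd_taylorAt_of_prod_mul _ j a (hμ j)
        rw [sum_through hij, ← h1] at h2
        convert X_pow_dvd_taylorAlong (w := w j) h2 using 2
        omega)
    have hBmem : (∏ k, ℓ k ^ a k) * B ∈
        idealOfVars (Fin 3) K ^ E * (⨅ j, pointIdeal (p j) ^ o j) ^ r := by
      have hle : Ideal.span {∏ k, ℓ k ^ a k} * boundedProducts ℓ i (fun k => r - a k) (D + 1) ≤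
          (⨅ j, pointIdeal (p j) ^ o j) ^ r := by
        rw [boundedProducts, Ideal.span_mul_span', Ideal.span_le]
        rintro _ ⟨_, rfl, _, ⟨v, hv, -, hvD, rfl⟩, rfl⟩
        simp only [SetLike.mem_coe, ← Finset.prod_mul_distrib, ← pow_add]
        refine h.prod_pow_mem ho (a := fun k => a k + v k) (fun k => ?_) ?_ hn
        · have := hv k
          have := ha k
          dsimp only at *
          omega
        · rw [Finset.sum_add_distrib, hvD, hD]
      refine Ideal.mul_mono_right hle ?_
      rw [mul_left_comm]
      exact Ideal.mul_mem_mul (Ideal.mem_span_singleton_self _) hB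
    rw [mul_add]
    refine Ideal.add_mem _ ?_ hBmem
    obtain ⟨A', hA', hAA'⟩ : ∃ A' : MvPolynomial (Fin 3) K, A'.IsHomogeneous (E + D) ∧
        ℓ i * A = ℓ i * A' := by
      refine ⟨_, homogeneousComponent_isHomogeneous (E + D) A, ?_⟩
      rw [← (h.isHomogeneous i).homogeneousComponent_mul, add_comm 1, add_assoc,
        homogeneousComponent_eq_self hA]
    rw [hAA', ← mul_assoc, ← prod_pow_add_single]
    refine ih (add_single_le ha hi) ?_ hA' fun j => ?_
    · simp only [Pi.add_apply, Finset.sum_add_distrib, Finset.sum_pi_single', Finset.mem_univ,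
        if_true]
      omega
    · rw [prod_pow_add_single, mul_assoc, ← hAA']
      have h1 := hμ j
      rw [mul_add, map_add] at h1
      have hle : idealOfVars (Fin 3) K ^ E * (⨅ j, pointIdeal (p j) ^ o j) ^ r ≤
          (⨅ j, pointIdeal (p j) ^ o j) ^ r := Ideal.mul_le_right
      have h2 := X_pow_dvd_taylorAt_of_mem (p := p) (o := o) (hle hBmem) j
      exact (dvd_add_left h2).1 h1

end IsSingularLocus

end Arrangement

theorem homogeneousComponent_mem_iInf_pointIdeal_pow {K ι : Type*} [Field K]
    (p : ι → Fin 3 → K) (e : ι → ℕ)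
    {F : MvPolynomial (Fin 3) K} (hF : F ∈ ⨅ j, pointIdeal (p j) ^ e j) (d : ℕ) :
    MvPolynomial.homogeneousComponent d F ∈ ⨅ j, pointIdeal (p j) ^ e j := by
  let _ := MvPolynomial.gradedAlgebra (σ := Fin 3) (R := K)
  have hp : ∀ j, (pointIdeal (p j)).IsHomogeneous (MvPolynomial.homogeneousSubmodule (Fin 3) K) :=
    fun j => Ideal.homogeneous_span _ _ fun f hf => ⟨1, hf.1⟩
  have hI : (⨅ j, pointIdeal (p j) ^ e j).IsHomogeneous
      (MvPolynomial.homogeneousSubmodule (Fin 3) K) := by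
    refine Ideal.IsHomogeneous.iInf fun j => ?_
    induction e j with
    | zero => rw [pow_zero, Ideal.one_eq_top]; exact Ideal.IsHomogeneous.top _
    | succ k ih => rw [pow_succ]; exact ih.mul (hp j)
  have := hI d hF
  rwa [← MvPolynomial.decomposition.decompose'_apply]

theorem IsSingularLocus.of_complete {K : Type*} [Field K] {n s : ℕ}
    {ℓ : Fin n → MvPolynomial (Fin 3) K}
    (hl : ∀ i, (ℓ i).IsHomogeneous 1) (hnz : ∀ i, ℓ i ≠ 0)
    (hprop : ∀ i j, i ≠ j → ∀ c : K, ℓ i ≠ c • ℓ j)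
    (hrank : ∀ q : Fin 3 → K, (∀ i, MvPolynomial.eval q (ℓ i) = 0) → q = 0)
    {p : Fin s → (Fin 3 → K)} (hp : ∀ j, p j ≠ 0)
    (hpdist : ∀ j k, j ≠ k → ∀ c : K, p j ≠ c • p k)
    (hcomplete : ∀ q : Fin 3 → K, q ≠ 0 →
      2 ≤ (Finset.univ.filter (fun i => MvPolynomial.eval q (ℓ i) = 0)).card →
      ∃ j, ∃ c : K, q = c • p j) : IsSingularLocus ℓ p where
  isHomogeneous := hl
  ne_zero := hnz
  point_ne_zero := hp
  mem_span {i k j} hik hi hk f hf hfj := by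
    obtain ⟨a, b, rfl⟩ := Submodule.mem_span_pair.1 (mem_span_pair_of_common_zero (hl i) (hl k) hf
      (hnz k) (hprop i k hik) (hp j) hi hk hfj)
    exact Ideal.mem_span_pair.2
      ⟨.C a, .C b, by rw [MvPolynomial.smul_eq_C_mul, MvPolynomial.smul_eq_C_mul]⟩
  exists_point {i k} hik := by
    obtain ⟨q, hq, hi, hk⟩ := exists_common_zero (hl i) (hl k)
    obtain ⟨j, c, rfl⟩ := hcomplete q hq
      (Finset.one_lt_card.2 ⟨i, by simpa using hi, k, by simpa using hk, hik⟩)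
    have hc : c ≠ 0 := by
      rintro rfl
      simp at hq
    have key : ∀ t, MvPolynomial.eval (c • p j) (ℓ t) = 0 → MvPolynomial.eval (p j) (ℓ t) = 0 := by
      intro t ht
      obtain ⟨u, hu⟩ := (hl t).exists_eq_sum
      rw [hu, eval_sum_C_mul_X] at ht ⊢
      rw [dotProduct_smul, smul_eq_mul] at ht
      exact (mul_eq_zero.1 ht).resolve_left hc
    exact ⟨j, key i hi, key k hk⟩
  point_unique {i k j j'} hik hi hk hi' hk' := by
    by_contra hne
    obtain ⟨c, hc⟩ := exists_smul_eq_of_common_zeros (hl i) (hl k) (hnz k) (hprop i k hik) (hp j)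
      hi hk hi' hk'
    exact hpdist j' j (Ne.symm hne) c hc
  exists_not_through j := by
    by_contra! hall
    exact hp j (hrank _ hall)

theorem two_le_of_rank {K : Type*} [Field K] {n : ℕ} {ℓ : Fin n → MvPolynomial (Fin 3) K}
    (hl : ∀ i, (ℓ i).IsHomogeneous 1)
    (hrank : ∀ q : Fin 3 → K, (∀ i, MvPolynomial.eval q (ℓ i) = 0) → q = 0) : 2 ≤ n := by
  by_contra! hn
  have : Subsingleton (Fin n) := Fin.subsingleton_iff_le_one.2 (by omega)
  rcases isEmpty_or_nonempty (Fin n) with hn0 | ⟨⟨i⟩⟩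
  · exact one_ne_zero (hrank 1 fun i => hn0.elim i)
  · obtain ⟨q, hq, hqi, -⟩ := exists_common_zero (hl i) (hl i)
    exact hq (hrank q fun k => by rwa [Subsingleton.elim k i])

/-- Corollary 3.5(1): for the fat points ideal `I = ∩ I(P_j)^(n_j - 1)` of a rank-3 arrangement
of `n` lines in `ℙ²_K` (char `K = 0`), one has `I^(2r-1) ⊆ M^(r-1) · I^r` for all `r ≥ 1`,
where `M = ⟨x, y, z⟩`. -/
theorem stmt14 {K : Type*} [Field K] [CharZero K] (n s : ℕ)
    (ℓ : Fin n → MvPolynomial (Fin 3) K)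
    (hl : ∀ i, (ℓ i).IsHomogeneous 1) (hnz : ∀ i, ℓ i ≠ 0)
    (hprop : ∀ i j, i ≠ j → ∀ c : K, ℓ i ≠ c • ℓ j)
    (hrank : ∀ q : Fin 3 → K, (∀ i, MvPolynomial.eval q (ℓ i) = 0) → q = 0)
    (p : Fin s → (Fin 3 → K)) (hp : ∀ j, p j ≠ 0)
    (hpdist : ∀ j k, j ≠ k → ∀ c : K, p j ≠ c • p k)
    (m : Fin s → ℕ)
    (hm : ∀ j, m j = (Finset.univ.filter
      (fun i => MvPolynomial.eval (p j) (ℓ i) = 0)).card)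
    (hsing : ∀ j, 2 ≤ m j)
    (hcomplete : ∀ q : Fin 3 → K, q ≠ 0 →
      2 ≤ (Finset.univ.filter (fun i => MvPolynomial.eval q (ℓ i) = 0)).card →
      ∃ j, ∃ c : K, q = c • p j)
    (r : ℕ) (hr : 1 ≤ r) :
    (⨅ j, pointIdeal (p j) ^ ((2 * r - 1) * (m j - 1))) ≤
      (Ideal.span (Set.range (MvPolynomial.X (R := K) (σ := Fin 3)))) ^ (r - 1) *
        (⨅ j, pointIdeal (p j) ^ (m j - 1)) ^ r := by
  have h := IsSingularLocus.of_complete hl hnz hprop hrank hp hpdist hcomplete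
  have hn := two_le_of_rank hl hrank
  have ho : ∀ j, (Finset.univ.filter
      (fun i => MvPolynomial.eval (p j) (ℓ i) = 0)).card = m j - 1 + 1 := fun j => by
    rw [← hm j]
    have := hsing j
    omega
  have ho1 : ∀ j, 1 ≤ m j - 1 := fun j => Nat.le_sub_one_of_lt (hsing j)
  intro F hF
  rw [← MvPolynomial.sum_homogeneousComponent F]
  refine Ideal.sum_mem _ fun d _ => ?_
  have hd := MvPolynomial.homogeneousComponent_isHomogeneous d F
  have hμ : ∀ j, Polynomial.X ^ ((2 * r - 1) * (m j - 1)) ∣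
      taylorAt (p j) (MvPolynomial.homogeneousComponent d F) := fun j =>
    X_pow_dvd_taylorAt_of_mem_pow
      ((Ideal.mem_iInf.1 (homogeneousComponent_mem_iInf_pointIdeal_pow p _ hF d)) j)
  rcases lt_or_ge (d + 1) (r * n) with hlt | hge
  · rw [h.eq_zero_of_degree_lt ho ho1 hn (a := 0) (r := r) (by simp) (by simpa using hlt) hd
      (by simpa using hμ)]
    exact Ideal.zero_mem _
  · have hrn : r * (n - 1) + r = r * n := by
      rw [← Nat.mul_succ, Nat.succ_eq_add_one, Nat.sub_add_cancel (by omega)]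
    obtain ⟨E, rfl⟩ := Nat.exists_eq_add_of_le' (show r * (n - 1) ≤ d by omega)
    have hmem := h.mem_pow_of_X_pow_dvd ho (a := 0) (r := r) (by omega) (by simp) (by simp) hd
      fun j => by
        simpa using (pow_dvd_pow _ (Nat.mul_le_mul_right _ (by omega))).trans (hμ j)
    have hmem' := Ideal.mul_mono_left (Ideal.pow_le_pow_right (show r - 1 ≤ E by omega)) hmem
    simpa [MvPolynomial.idealOfVars] using hmem'
end
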